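/- Let a < b be real numbers and let f : ℝ → ℝ be four times continuously differentiable on [a,b]. Suppose reals la ≤ f(a) ≤ ua, lm ≤ f((a+b)/2) ≤ um, lb ≤ f(b) ≤ ub, and L ≤ f⁗(x) ≤ U for all x ∈ [a,b]. Then ((b−a)/6)·(la + 4·lm + lb) − ((b−a)^5/2880)·U ≤ ∫_a^b f(x) dx ≤ ((b−a)/6)·(ua + 4·um + ub) − ((b−a)^5/2880)·L. -/

import Mathlib

open Set intervalIntegral

/-- The Peano kernel of Simpson's rule on the half interval from the midpoint `c` to the
endpoint `e`. -/
noncomputable def simpsonKernel (c e x : ℝ) : ℝ := (e - x) ^ 4 / 24 - (e - c) * (e - x) ^ 3 / 18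

theorem continuous_simpsonKernel (c e : ℝ) : Continuous (simpsonKernel c e) := by
  unfold simpsonKernel
  fun_prop

theorem simpsonKernel_nonpos_right {c e x : ℝ} (hx : x ∈ Icc c e) : simpsonKernel c e x ≤ 0 := by
  have h1 : 0 ≤ (e - x) ^ 3 := pow_nonneg (by linarith [hx.2]) 3
  have h2 : 0 ≤ 4 * (e - c) - 3 * (e - x) := by linarith [hx.1, hx.2]
  unfold simpsonKernel
  linear_combination (mul_nonneg h1 h2) / 72

theorem simpsonKernel_nonpos_left {c e x : ℝ} (hx : x ∈ Icc e c) : simpsonKernel c e x ≤ 0 := by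
  have h1 : 0 ≤ (x - e) ^ 3 := pow_nonneg (by linarith [hx.1]) 3
  have h2 : 0 ≤ 4 * (c - e) - 3 * (x - e) := by linarith [hx.1, hx.2]
  unfold simpsonKernel
  linear_combination (mul_nonneg h1 h2) / 72

theorem integral_simpsonKernel (c e : ℝ) :
    ∫ x in c..e, simpsonKernel c e x = -(e - c) ^ 5 / 180 := by
  have key : ∀ x ∈ uIcc c e, HasDerivAt
      (fun x => -(e - x) ^ 5 / 120 + (e - c) * (e - x) ^ 4 / 72) (simpsonKernel c e x) x := by
    intro x _
    have hy : HasDerivAt (fun x => e - x) (-1) x := by simpa using (hasDerivAt_id x).const_sub e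
    refine (((hy.pow 5).neg.div_const 120).add
      (((hy.pow 4).const_mul (e - c)).div_const 72)).congr_deriv ?_
    unfold simpsonKernel
    push_cast
    ring
  rw [integral_eq_sub_of_hasDerivAt key ((continuous_simpsonKernel c e).intervalIntegrable _ _)]
  ring

/-- Fourfold integration by parts against the Simpson kernel; `c` and `e` may come in either
order. -/
theorem integral_eq_integral_simpsonKernel_mul_add {c e : ℝ} {f f₁ f₂ f₃ f₄ : ℝ → ℝ}
    (hf : ContinuousOn f (uIcc c e)) (hf₁ : ContinuousOn f₁ (uIcc c e))
    (hf₂ : ContinuousOn f₂ (uIcc c e)) (hf₃ : ContinuousOn f₃ (uIcc c e))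
    (hf₄ : ContinuousOn f₄ (uIcc c e))
    (hd : ∀ x ∈ Ioo (min c e) (max c e), HasDerivAt f (f₁ x) x)
    (hd₁ : ∀ x ∈ Ioo (min c e) (max c e), HasDerivAt f₁ (f₂ x) x)
    (hd₂ : ∀ x ∈ Ioo (min c e) (max c e), HasDerivAt f₂ (f₃ x) x)
    (hd₃ : ∀ x ∈ Ioo (min c e) (max c e), HasDerivAt f₃ (f₄ x) x) :
    ∫ x in c..e, f x = (∫ x in c..e, simpsonKernel c e x * f₄ x) + (e - c) / 3 * f e
      + 2 * (e - c) / 3 * f c + (e - c) ^ 2 / 6 * f₁ c - (e - c) ^ 4 / 72 * f₃ c := by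
  have hK := (continuous_simpsonKernel c e).continuousOn (s := uIcc c e)
  have hi : IntervalIntegrable (fun x => simpsonKernel c e x * f₄ x) MeasureTheory.volume c e :=
    (hK.mul hf₄).intervalIntegrable
  have key := integral_eq_sub_of_hasDeriv_right
    (f := fun x => ((e - x) ^ 4 / 24 - (e - c) * (e - x) ^ 3 / 18) * f₃ x
      + ((e - x) ^ 3 / 6 - (e - c) * (e - x) ^ 2 / 6) * f₂ x
      + ((e - x) ^ 2 / 2 - (e - c) * (e - x) / 3) * f₁ x
      + ((e - x) - (e - c) / 3) * f x)
    (f' := fun x => simpsonKernel c e x * f₄ x - f x) (a := c) (b := e) (by fun_prop) ?_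
    (hi.sub hf.intervalIntegrable)
  · rw [integral_sub hi hf.intervalIntegrable] at key
    linear_combination -key
  · intro x hx
    have hy : HasDerivAt (fun x => e - x) (-1) x := by simpa using (hasDerivAt_id x).const_sub e
    refine HasDerivAt.hasDerivWithinAt ?_
    refine ((((((((hy.pow 4).div_const 24).sub
      (((hy.pow 3).const_mul (e - c)).div_const 18)).mul (hd₃ x hx)).add
      ((((hy.pow 3).div_const 6).sub (((hy.pow 2).const_mul (e - c)).div_const 6)).mul
        (hd₂ x hx))).add
      ((((hy.pow 2).div_const 2).sub ((hy.const_mul (e - c)).div_const 3)).mul (hd₁ x hx))).add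
      ((hy.sub_const ((e - c) / 3)).mul (hd x hx)))).congr_deriv ?_
    simp only [simpsonKernel, Pi.pow_apply, Pi.sub_apply]
    push_cast
    ring

theorem integral_nonpos_mul_mem_Icc {p q L U : ℝ} {K g : ℝ → ℝ} (hpq : p ≤ q)
    (hK : Continuous K) (hK0 : ∀ x ∈ Icc p q, K x ≤ 0) (hg : ContinuousOn g (Icc p q))
    (hL : ∀ x ∈ Icc p q, L ≤ g x) (hU : ∀ x ∈ Icc p q, g x ≤ U) :
    ∫ x in p..q, K x * g x ∈ Icc ((∫ x in p..q, K x) * U) ((∫ x in p..q, K x) * L) := by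
  have hi : IntervalIntegrable (fun x => K x * g x) MeasureTheory.volume p q :=
    ContinuousOn.intervalIntegrable (by rw [uIcc_of_le hpq]; exact hK.continuousOn.mul hg)
  have hc (A : ℝ) : IntervalIntegrable (fun x => K x * A) MeasureTheory.volume p q :=
    (hK.mul continuous_const).intervalIntegrable _ _
  rw [← integral_mul_const, ← integral_mul_const]
  exact ⟨integral_mono_on hpq (hc U) hi
      fun x hx => mul_le_mul_of_nonpos_left (hU x hx) (hK0 x hx),
    integral_mono_on hpq hi (hc L)
      fun x hx => mul_le_mul_of_nonpos_left (hL x hx) (hK0 x hx)⟩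


/-- Interval version of Simpson's (1/3) rule: bounding the point values and the
fourth derivative yields a guaranteed enclosure of the integral. -/
theorem interval_simpson_rule (a b : ℝ) (hab : a < b) (f : ℝ → ℝ)
    (hf : ContDiffOn ℝ 4 f (Set.Icc a b))
    (la ua lm um lb ub L U : ℝ)
    (hla : la ≤ f a) (hua : f a ≤ ua)
    (hlm : lm ≤ f ((a + b) / 2)) (hum : f ((a + b) / 2) ≤ um)
    (hlb : lb ≤ f b) (hub : f b ≤ ub)
    (hL : ∀ x ∈ Set.Icc a b, L ≤ iteratedDerivWithin 4 f (Set.Icc a b) x)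
    (hU : ∀ x ∈ Set.Icc a b, iteratedDerivWithin 4 f (Set.Icc a b) x ≤ U) :
    ((b - a) / 6) * (la + 4 * lm + lb) - ((b - a) ^ 5 / 2880) * U
        ≤ ∫ x in a..b, f x ∧
    ∫ x in a..b, f x
        ≤ ((b - a) / 6) * (ua + 4 * um + ub) - ((b - a) ^ 5 / 2880) * L := by
  have hcont {n : ℕ} (hn : n ≤ 4) : ContinuousOn (iteratedDerivWithin n f (Icc a b)) (Icc a b) :=
    hf.continuousOn_iteratedDerivWithin (by exact_mod_cast hn) (uniqueDiffOn_Icc hab)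
  have hderiv {n : ℕ} (hn : n < 4) (x : ℝ) (hx : x ∈ Ioo a b) :
      HasDerivAt (iteratedDerivWithin n f (Icc a b))
        (iteratedDerivWithin (n + 1) f (Icc a b) x) x := by
    rw [iteratedDerivWithin_succ]
    exact ((hf.differentiableOn_iteratedDerivWithin (by exact_mod_cast hn) (uniqueDiffOn_Icc hab))
      x (Ioo_subset_Icc_self hx)).hasDerivWithinAt.hasDerivAt (Icc_mem_nhds hx.1 hx.2)
  obtain ⟨c, hc⟩ : ∃ c, c = (a + b) / 2 := ⟨_, rfl⟩
  rw [← hc] at hlm hum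
  have hac : a ≤ c := by linarith
  have hcb : c ≤ b := by linarith
  have hmem : c ∈ Icc a b := ⟨hac, hcb⟩
  have hhalf (e : ℝ) (he : e ∈ Icc a b) := by
    have hs : uIcc c e ⊆ Icc a b := uIcc_subset_Icc hmem he
    have ho : Ioo (min c e) (max c e) ⊆ Ioo a b :=
      Ioo_subset_Ioo (le_min hac he.1) (max_le hcb he.2)
    exact integral_eq_integral_simpsonKernel_mul_add (c := c) (e := e)
      ((hcont (n := 0) (by norm_num)).mono hs) ((hcont (n := 1) (by norm_num)).mono hs)
      ((hcont (n := 2) (by norm_num)).mono hs) ((hcont (n := 3) (by norm_num)).mono hs)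
      ((hcont (n := 4) (by norm_num)).mono hs)
      (fun x hx => hderiv (by norm_num) x (ho hx)) (fun x hx => hderiv (by norm_num) x (ho hx))
      (fun x hx => hderiv (by norm_num) x (ho hx)) (fun x hx => hderiv (by norm_num) x (ho hx))
  have hright := hhalf b (right_mem_Icc.2 hab.le)
  have hleft := hhalf a (left_mem_Icc.2 hab.le)
  simp only [iteratedDerivWithin_zero] at hright hleft
  have hsr : Icc c b ⊆ Icc a b := Icc_subset_Icc_left hac
  have hsl : Icc a c ⊆ Icc a b := Icc_subset_Icc_right hcb
  obtain ⟨hrU, hrL⟩ := integral_nonpos_mul_mem_Icc hcb (continuous_simpsonKernel c b)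
    (fun _ => simpsonKernel_nonpos_right) ((hcont le_rfl).mono hsr)
    (fun x hx => hL x (hsr hx)) (fun x hx => hU x (hsr hx))
  obtain ⟨hlU, hlL⟩ := integral_nonpos_mul_mem_Icc hac (continuous_simpsonKernel c a)
    (fun _ => simpsonKernel_nonpos_left) ((hcont le_rfl).mono hsl)
    (fun x hx => hL x (hsl hx)) (fun x hx => hU x (hsl hx))
  rw [integral_simpsonKernel] at hrU hrL
  simp only [integral_symm c a, integral_simpsonKernel] at hlU hlL
  have hint {p q : ℝ} (hp : p ∈ Icc a b) (hq : q ∈ Icc a b) :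
      IntervalIntegrable f MeasureTheory.volume p q :=
    (hf.continuousOn.mono (uIcc_subset_Icc hp hq)).intervalIntegrable
  have hsplit := integral_add_adjacent_intervals
    (hint (left_mem_Icc.2 hab.le) hmem) (hint hmem (right_mem_Icc.2 hab.le))
  rw [integral_symm c a] at hsplit
  have hba : 0 ≤ (b - a) / 6 := by linarith
  have hlow : (b - a) / 6 * (la + 4 * lm + lb) ≤ (b - a) / 6 * (f a + 4 * f c + f b) := by gcongr
  have hupp : (b - a) / 6 * (f a + 4 * f c + f b) ≤ (b - a) / 6 * (ua + 4 * um + ub) := by gcongr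
  subst hc
  constructor
  · linear_combination hlow + hrU + hlU - hright + hleft + hsplit
  · linear_combination hupp + hrL + hlL + hright - hleft - hsplit
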